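/- Let η be a Radon measure on ℝ^d such that ∫ ∂_v φ dη = 0 for all smooth compactly supported φ and all v in a k-dimensional linear subspace W of ℝ^d. Then η is W-invariant: T_{v,1}η = η for all v ∈ W, and there exists a Radon measure θ on W^⊥ such that η = θ ⊗ H^k⌞W. -/

import Mathlib

open MeasureTheory Metric Filter
open scoped FourierTransform ENNReal SchwartzMap

noncomputable section

/-- `ℝ^d` as a Euclidean space. -/
abbrev Euc (d : ℕ) := EuclideanSpace ℝ (Fin d)

/-- The measure `μ` admits `(p,q)` Fourier restriction with constant `C`:
`‖f̂‖_{L^q(μ)} ≤ C ‖f‖_{L^p(ℝ^d)}` for all Schwartz functions `f`. -/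
def HasRestriction {d : ℕ} (μ : Measure (Euc d)) (p q C : ℝ) : Prop :=
  ∀ f : 𝓢(Euc d, ℂ),
    eLpNorm (𝓕 (f : Euc d → ℂ)) (ENNReal.ofReal q) μ ≤
      ENNReal.ofReal C * eLpNorm (f : Euc d → ℂ) (ENNReal.ofReal p) volume

/-- The product measure `θ ⊗ H^k⌞W` on `ℝ^d = W ⊕ W^⊥`, where `θ` is a measure on `W^⊥`. -/
def tensorWith {d : ℕ} (W : Submodule ℝ (Euc d)) (θ : Measure ↥Wᗮ) (k : ℕ) :
    Measure (Euc d) :=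
  Measure.map (fun p : Euc d × Euc d => p.1 + p.2)
    ((Measure.map (Subtype.val : ↥Wᗮ → Euc d) θ).prod
      ((μH[(k : ℝ)] : Measure (Euc d)).restrict (W : Set (Euc d))))

section Extensionality

variable {E : Type*} [NormedAddCommGroup E] [NormedSpace ℝ E] [FiniteDimensional ℝ E]

/-- A smooth Urysohn lemma with compact support. -/
theorem exists_contDiff_hasCompactSupport_eqOn_one {K V : Set E} (hK : IsCompact K)
    (hV : IsOpen V) (hKV : K ⊆ V) :
    ∃ f : E → ℝ, ContDiff ℝ (⊤ : ℕ∞) f ∧ HasCompactSupport f ∧ (∀ x ∈ K, f x = 1) ∧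
      (∀ x ∉ V, f x = 0) ∧ ∀ x, f x ∈ Set.Icc (0 : ℝ) 1 := by
  obtain ⟨R, hR⟩ := hK.isBounded.subset_ball 0
  have hdisj : Disjoint (V ∩ ball 0 R)ᶜ K :=
    Set.disjoint_compl_left_iff_subset.2 (Set.subset_inter hKV hR)
  obtain ⟨f, hf0, hf1, hf⟩ := exists_contMDiffMap_zero_one_of_isClosed (n := (⊤ : ℕ∞))
    (modelWithCornersSelf ℝ E) (hV.inter isOpen_ball).isClosed_compl hK.isClosed hdisj
  refine ⟨f, f.contMDiff.contDiff, ?_, fun x hx => hf1 hx, fun x hx => hf0 fun h => hx h.1, hf⟩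
  refine HasCompactSupport.intro (isCompact_closedBall 0 R) fun x hx => hf0 fun h => hx ?_
  exact ball_subset_closedBall h.2

variable [MeasurableSpace E] [BorelSpace E] {μ ν : Measure E}
  [IsLocallyFiniteMeasure μ] [IsLocallyFiniteMeasure ν]

theorem measure_le_of_isCompact_of_integral_contDiff
    (h : ∀ f : E → ℝ, ContDiff ℝ (⊤ : ℕ∞) f → HasCompactSupport f →
      ∫ x, f x ∂μ ≤ ∫ x, f x ∂ν) {K : Set E} (hK : IsCompact K) : μ K ≤ ν K := by
  rw [hK.measure_eq_iInf_isOpen (μ := ν)]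
  refine le_iInf₂ fun V hKV => le_iInf fun hV => ?_
  obtain ⟨f, hf, hfc, hfK, hfV, hf01⟩ := exists_contDiff_hasCompactSupport_eqOn_one hK hV hKV
  calc
    μ K = ∫⁻ x, K.indicator 1 x ∂μ := (lintegral_indicator_one hK.measurableSet).symm
    _ ≤ ∫⁻ x, ENNReal.ofReal (f x) ∂μ := by
      refine lintegral_mono fun x => ?_
      by_cases hx : x ∈ K <;> simp [hx, hfK]
    _ = ENNReal.ofReal (∫ x, f x ∂μ) := (ofReal_integral_eq_lintegral_ofReal
      (hf.continuous.integrable_of_hasCompactSupport hfc) (.of_forall fun x => (hf01 x).1)).symm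
    _ ≤ ENNReal.ofReal (∫ x, f x ∂ν) := ENNReal.ofReal_le_ofReal (h f hf hfc)
    _ = ∫⁻ x, ENNReal.ofReal (f x) ∂ν := ofReal_integral_eq_lintegral_ofReal
      (hf.continuous.integrable_of_hasCompactSupport hfc) (.of_forall fun x => (hf01 x).1)
    _ ≤ ∫⁻ x, V.indicator 1 x ∂ν := by
      refine lintegral_mono fun x => ?_
      by_cases hx : x ∈ V
      · simpa [hx] using (hf01 x).2
      · simp [hx, hfV]
    _ = ν V := lintegral_indicator_one hV.measurableSet

/-- Locally finite measures are determined by their integrals against test functions. -/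
theorem measure_ext_of_integral_contDiff
    (h : ∀ f : E → ℝ, ContDiff ℝ (⊤ : ℕ∞) f → HasCompactSupport f →
      ∫ x, f x ∂μ = ∫ x, f x ∂ν) : μ = ν := by
  refine Measure.OuterRegular.ext_isOpen ?_
  apply Measure.InnerRegularWRT.eq_of_innerRegularWRT_of_forall_eq Measure.Regular.innerRegular
    Measure.Regular.innerRegular
  refine fun K hK => le_antisymm ?_ ?_
  · exact measure_le_of_isCompact_of_integral_contDiff (fun f hf hfc => (h f hf hfc).le) hK
  · exact measure_le_of_isCompact_of_integral_contDiff (fun f hf hfc => (h f hf hfc).ge) hK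

end Extensionality

section Translation

variable {E : Type*} [NormedAddCommGroup E] [NormedSpace ℝ E] [FiniteDimensional ℝ E]
  [MeasurableSpace E] [BorelSpace E] {η : Measure E} [IsLocallyFiniteMeasure η]

theorem hasDerivAt_integral_comp_add_smul {φ : E → ℝ} (hφ : ContDiff ℝ 1 φ)
    (hc : HasCompactSupport φ) (v : E) (t : ℝ) :
    HasDerivAt (fun s : ℝ => ∫ y, φ (y + s • v) ∂η) (∫ y, fderiv ℝ φ (y + t • v) v ∂η) t := by
  have hD : Continuous fun x => fderiv ℝ φ x v :=
    (hφ.continuous_fderiv one_ne_zero).clm_apply continuous_const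
  have hDc : HasCompactSupport fun x => fderiv ℝ φ x v := hc.fderiv_apply ℝ v
  obtain ⟨C, hC⟩ := hD.bounded_above_of_compact_support hDc
  obtain ⟨R, hR⟩ := hDc.isCompact.isBounded.subset_closedBall 0
  set B : Set E := closedBall 0 (R + (|t| + 1) * ‖v‖)
  have hshift : ∀ s : ℝ, Continuous fun y : E => y + s • v := fun s => by fun_prop
  refine (hasDerivAt_integral_of_dominated_loc_of_deriv_le (F := fun s y => φ (y + s • v))
    (F' := fun s y => fderiv ℝ φ (y + s • v) v) (bound := B.indicator fun _ => C)
    (ball_mem_nhds t one_pos) (.of_forall fun s => ?_) ?_ ?_ (.of_forall fun y s hs => ?_) ?_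
    (.of_forall fun y s _ => ?_)).2
  · exact (hφ.continuous.comp (hshift s)).aestronglyMeasurable
  · exact (hφ.continuous.comp (hshift t)).integrable_of_hasCompactSupport
      (hc.comp_homeomorph (Homeomorph.addRight (t • v)))
  · exact (hD.comp (hshift t)).aestronglyMeasurable
  · by_cases hy : y ∈ B
    · simpa [hy] using hC (y + s • v)
    · have : fderiv ℝ φ (y + s • v) v = 0 := by
        refine image_eq_zero_of_notMem_tsupport (f := fun x => fderiv ℝ φ x v)
          fun hmem => hy ?_
        have h1 : ‖y + s • v‖ ≤ R := by simpa using hR hmem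
        have h2 : |s| ≤ |t| + 1 := by
          rw [mem_ball, Real.dist_eq] at hs
          linarith [abs_sub_abs_le_abs_sub s t]
        have h3 : ‖y‖ ≤ ‖y + s • v‖ + ‖s • v‖ := by
          simpa using norm_sub_le (y + s • v) (s • v)
        rw [norm_smul, Real.norm_eq_abs] at h3
        rw [mem_closedBall_zero_iff]
        nlinarith [mul_le_mul_of_nonneg_right h2 (norm_nonneg v)]
      simp [hy, this]
  · exact (integrable_indicator_iff measurableSet_closedBall).2
      (continuousOn_const.integrableOn_compact (isCompact_closedBall _ _))
  · have h1 : HasDerivAt (fun s : ℝ => y + s • v) v s := by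
      simpa using ((hasDerivAt_id s).smul_const v).const_add y
    exact ((hφ.differentiable one_ne_zero _).hasFDerivAt).comp_hasDerivAt s h1

/-- A locally finite measure with vanishing distributional derivative in the direction `v` is
invariant under translation by `v`. -/
theorem map_add_right_eq_of_integral_fderiv_eq_zero {v : E}
    (h : ∀ φ : E → ℝ, ContDiff ℝ (⊤ : ℕ∞) φ → HasCompactSupport φ →
      ∫ y, fderiv ℝ φ y v ∂η = 0) :
    Measure.map (fun y => y + v) η = η := by
  have : (Measure.map (fun y => y + v) η).Regular := Measure.Regular.map (Homeomorph.addRight v)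
  refine measure_ext_of_integral_contDiff fun φ hφ hc => ?_
  rw [integral_map (by fun_prop) hφ.continuous.aestronglyMeasurable]
  have hderiv : ∀ t : ℝ, HasDerivAt (fun s : ℝ => ∫ y, φ (y + s • v) ∂η) 0 t := fun t => by
    have hz : ∫ y, fderiv ℝ φ (y + t • v) v ∂η = 0 := by
      simpa only [fderiv_comp_add_right] using h (fun y => φ (y + t • v)) (by fun_prop)
        (hc.comp_homeomorph (Homeomorph.addRight (t • v)))
    exact hz ▸ hasDerivAt_integral_comp_add_smul (hφ.of_le (by exact_mod_cast le_top)) hc v t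
  simpa using is_const_of_deriv_eq_zero (fun t => (hderiv t).differentiableAt)
    (fun t => (hderiv t).deriv) 1 0

end Translation

section Disintegration

variable {d : ℕ} (W : Submodule ℝ (Euc d))

theorem map_subtype_hausdorffMeasure (k : ℕ) :
    Measure.map (Subtype.val : W → Euc d) μH[(k : ℝ)] =
      (μH[(k : ℝ)] : Measure (Euc d)).restrict (W : Set (Euc d)) := by
  rw [isometry_subtype_coe.map_hausdorffMeasure (.inl k.cast_nonneg)]
  simp

/-- The measure on `Wᗮ` with `A ↦ c • η (A + ball)`, the ball being the unit ball of `W`. -/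
def transverseMeasure (c : ℝ≥0∞) (η : Measure (Euc d)) : Measure Wᗮ :=
  c • Measure.map (fun y => Wᗮ.orthogonalProjectionOnto y)
    (η.restrict ((fun y => W.orthogonalProjectionOnto y) ⁻¹' ball 0 1))

theorem isLocallyFiniteMeasure_transverseMeasure {c : ℝ≥0∞} (hc : c ≠ ∞) (η : Measure (Euc d))
    [IsLocallyFiniteMeasure η] : IsLocallyFiniteMeasure (transverseMeasure W c η) := by
  refine ⟨fun x => ⟨ball x 1, ball_mem_nhds x one_pos, ?_⟩⟩
  rw [transverseMeasure, Measure.smul_apply, smul_eq_mul,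
    Measure.map_apply (by fun_prop) measurableSet_ball,
    Measure.restrict_apply (measurableSet_ball.preimage (by fun_prop))]
  refine ENNReal.mul_lt_top hc.lt_top
    (Bornology.IsBounded.measure_lt_top
      ((isBounded_ball (x := (0 : Euc d)) (r := ‖x‖ + 2)).subset ?_))
  rintro y ⟨h1, h2⟩
  simp only [Set.mem_preimage, mem_ball, dist_eq_norm, sub_zero] at h1 h2 ⊢
  have h3 : ‖y‖ ≤ ‖W.orthogonalProjectionOnto y‖ + ‖Wᗮ.orthogonalProjectionOnto y‖ := by
    have := norm_add_le (W.starProjection y) (Wᗮ.starProjection y)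
    rwa [W.starProjection_add_starProjection_orthogonal] at this
  have h4 := norm_le_norm_add_norm_sub' (Wᗮ.orthogonalProjectionOnto y) x
  linarith

theorem lintegral_tensorWith {k : ℕ} (θ : Measure Wᗮ) [SFinite θ] (hW : Module.finrank ℝ W = k)
    {f : Euc d → ℝ≥0∞} (hf : Measurable f) :
    ∫⁻ x, f x ∂(tensorWith W θ k) = ∫⁻ u, ∫⁻ w : W, f (u + w) ∂μH[(k : ℝ)] ∂θ := by
  subst hW
  rw [tensorWith, lintegral_map hf (by fun_prop), ← map_subtype_hausdorffMeasure,
    Measure.map_prod_map _ _ measurable_subtype_coe measurable_subtype_coe,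
    lintegral_map (by fun_prop) (by fun_prop), lintegral_prod _ (by fun_prop)]
  rfl

theorem eq_tensorWith_transverseMeasure {k : ℕ} (hW : Module.finrank ℝ W = k) (η : Measure (Euc d))
    [IsLocallyFiniteMeasure η] (hη : ∀ v ∈ W, Measure.map (fun y => y + v) η = η) :
    η = tensorWith W (transverseMeasure W (μH[(k : ℝ)] (ball (0 : W) 1))⁻¹ η) k := by
  subst hW
  set k := Module.finrank ℝ W
  set m : Measure W := μH[(k : ℝ)]
  have hpos : m (ball 0 1) ≠ 0 := (measure_ball_pos m 0 one_pos).ne'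
  have hfin : m (ball 0 1) ≠ ∞ := measure_ball_lt_top.ne
  have := isLocallyFiniteMeasure_transverseMeasure W (ENNReal.inv_ne_top.2 hpos) η
  set P : Euc d → W := fun y => W.orthogonalProjectionOnto y with hP
  have hPm : Measurable P := by fun_prop
  have hPadd : ∀ (y : Euc d) (w : W), P (y + w) = P y + w := fun y w => by simp [hP]
  have hdecomp : ∀ y : Euc d, (Wᗮ.orthogonalProjectionOnto y : Euc d) + P y = y := fun y => by
    rw [add_comm]
    exact W.starProjection_add_starProjection_orthogonal y
  have hBm : MeasurableSet (P ⁻¹' ball 0 1) := measurableSet_ball.preimage hPm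
  refine Measure.ext_of_lintegral _ fun f hf => ?_
  symm
  have hind : Measurable fun q : Euc d × W => (P ⁻¹' ball 0 1).indicator (1 : Euc d → ℝ≥0∞) q.1 :=
    (measurable_one.indicator hBm).comp measurable_fst
  calc
    ∫⁻ x, f x ∂(tensorWith W (transverseMeasure W (m (ball 0 1))⁻¹ η) k)
      = (m (ball 0 1))⁻¹ * ∫⁻ y in P ⁻¹' ball 0 1,
          ∫⁻ w : W, f (Wᗮ.orthogonalProjectionOnto y + w) ∂m ∂η := by
        rw [lintegral_tensorWith W _ rfl hf, transverseMeasure, lintegral_smul_measure,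
          lintegral_map (Measurable.lintegral_prod_right' (f := fun q : Wᗮ × W => f (q.1 + q.2))
            (by fun_prop)) (by fun_prop), smul_eq_mul]
    _ = (m (ball 0 1))⁻¹ * ∫⁻ y in P ⁻¹' ball 0 1, ∫⁻ w : W, f (y + w) ∂m ∂η := by
        congr 1
        refine lintegral_congr fun y => ?_
        rw [← lintegral_add_left_eq_self _ (P y)]
        refine lintegral_congr fun w => ?_
        rw [Submodule.coe_add, ← add_assoc, hdecomp]
    _ = (m (ball 0 1))⁻¹ * ∫⁻ y, ∫⁻ w : W,
          (P ⁻¹' ball 0 1).indicator 1 y * f (y + w) ∂m ∂η := by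
        rw [← lintegral_indicator hBm]
        congr 1
        refine lintegral_congr fun y => ?_
        by_cases hy : y ∈ P ⁻¹' ball 0 1 <;> simp [hy]
    _ = (m (ball 0 1))⁻¹ * ∫⁻ w : W, ∫⁻ y,
          (P ⁻¹' ball 0 1).indicator 1 y * f (y + w) ∂η ∂m := by
        rw [lintegral_lintegral_swap]
        exact (hind.mul (by fun_prop)).aemeasurable
    _ = (m (ball 0 1))⁻¹ * ∫⁻ w : W, ∫⁻ y,
          (ball (P y) 1).indicator 1 w * f y ∂η ∂m := by
        congr 1
        refine lintegral_congr fun w => ?_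
        conv_lhs => rw [← hη _ (-w).2]
        have hg : Measurable fun y : Euc d =>
            (P ⁻¹' ball 0 1).indicator (1 : Euc d → ℝ≥0∞) y * f (y + w) :=
          (measurable_one.indicator hBm).mul (by fun_prop)
        rw [lintegral_map hg (by fun_prop)]
        refine lintegral_congr fun y => ?_
        congr 1
        · have hiff : y + ((-w : W) : Euc d) ∈ P ⁻¹' ball 0 1 ↔ w ∈ ball (P y) 1 := by
            rw [Set.mem_preimage, hPadd, mem_ball_zero_iff, mem_ball_iff_norm', sub_eq_add_neg]
          by_cases hw : w ∈ ball (P y) 1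
          · rw [Set.indicator_of_mem hw, Set.indicator_of_mem (hiff.2 hw)]
            rfl
          · rw [Set.indicator_of_notMem hw, Set.indicator_of_notMem (mt hiff.1 hw)]
        · simp
    _ = (m (ball 0 1))⁻¹ * ∫⁻ y, ∫⁻ w : W, (ball (P y) 1).indicator 1 w * f y ∂m ∂η := by
        rw [lintegral_lintegral_swap]
        have hS : MeasurableSet {q : W × Euc d | dist q.1 (P q.2) < 1} :=
          measurableSet_lt (by fun_prop) measurable_const
        exact ((measurable_one.indicator hS).mul (by fun_prop)).aemeasurable
    _ = (m (ball 0 1))⁻¹ * ∫⁻ y, m (ball 0 1) * f y ∂η := by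
        congr 1
        refine lintegral_congr fun y => ?_
        rw [lintegral_mul_const _ (measurable_one.indicator measurableSet_ball),
          lintegral_indicator_one measurableSet_ball, Measure.addHaar_ball_center]
    _ = ∫⁻ y, f y ∂η := by
        rw [lintegral_const_mul _ hf, ← mul_assoc, ENNReal.inv_mul_cancel hpos hfin, one_mul]

end Disintegration

/-- If a Radon measure `η` on `ℝ^d` satisfies `∫ ∂_v φ dη = 0` for every smooth compactly
supported `φ` and every `v` in a `k`-dimensional subspace `W`, then `η` is invariant
under all translations by vectors of `W`, and `η = θ ⊗ H^k⌞W` for some Radon measure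
`θ` on `W^⊥`. -/
theorem invariance_of_translation_invariant_measure (d k : ℕ)
    (W : Submodule ℝ (Euc d)) (hW : Module.finrank ℝ W = k)
    (η : Measure (Euc d)) [IsLocallyFiniteMeasure η]
    (h : ∀ v ∈ W, ∀ φ : Euc d → ℝ, ContDiff ℝ (⊤ : ℕ∞) φ → HasCompactSupport φ →
      ∫ y, fderiv ℝ φ y v ∂η = 0) :
    (∀ v ∈ W, Measure.map (fun y => y + v) η = η) ∧
    ∃ θ : Measure ↥Wᗮ, IsLocallyFiniteMeasure θ ∧ η = tensorWith W θ k := by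
  have hinv : ∀ v ∈ W, Measure.map (fun y => y + v) η = η := fun v hv =>
    map_add_right_eq_of_integral_fderiv_eq_zero (h v hv)
  refine ⟨hinv, _, ?_, eq_tensorWith_transverseMeasure W hW η hinv⟩
  subst hW
  exact isLocallyFiniteMeasure_transverseMeasure W
    (ENNReal.inv_ne_top.2 (measure_ball_pos _ 0 one_pos).ne') η

end
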